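/- Let k > 1, let n₁ ≥ ⋯ ≥ n_k ≥ 2 be positive integers, let N = ∏_{i=1}^k n_i, and let Ψ : H_N → H_N be an ℝ-linear map on the space of N×N Hermitian matrices (identified with ⊗_{i=1}^k H_{n_i} via the Kronecker product). Then Ψ(⊗_{i=1}^k P_{n_i}) = ⊗_{i=1}^k P_{n_i} if and only if there is a permutation π of {1,…,k} with n_{π(i)} = n_i for all i, and ℝ-linear maps ψ_i on H_{n_i}, each of the form X ↦ U_i X U_i* or X ↦ U_i Xᵀ U_i* for some unitary U_i ∈ M_{n_i}, such that Ψ(⊗_{i=1}^k A_i) = ⊗_{i=1}^k ψ_i(A_{π(i)}) for all A_i ∈ H_{n_i}, i = 1,…,k. -/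

import Mathlib

open Matrix

/-- The real vector space of `m × m` complex Hermitian matrices. -/
noncomputable abbrev Herm (m : ℕ) := selfAdjoint (Matrix (Fin m) (Fin m) ℂ)

/-- A pure state: a rank-one Hermitian matrix of trace one. -/
def IsPureState {m : ℕ} (A : Matrix (Fin m) (Fin m) ℂ) : Prop :=
  A.IsHermitian ∧ A.rank = 1 ∧ A.trace = 1

/-- The tensor (Kronecker) product `⊗_{i=1}^k A_i` of matrices `A_i` of sizes `n_i × n_i`,
the `N × N` matrix (`N = ∏ n_i`) with entries
`(⊗ A_i)((x₁,…,x_k),(y₁,…,y_k)) = ∏_i A_i(x_i, y_i)`. -/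
def tensorPi {k : ℕ} {n : Fin k → ℕ} (A : ∀ i, Matrix (Fin (n i)) (Fin (n i)) ℂ) :
    Matrix (∀ i, Fin (n i)) (∀ i, Fin (n i)) ℂ :=
  Matrix.of fun x y => ∏ i, A i (x i) (y i)

/-- The tensor product of Hermitian matrices, as a Hermitian matrix. -/
noncomputable def tensorSA {k : ℕ} {n : Fin k → ℕ} (A : ∀ i, Herm (n i)) :
    selfAdjoint (Matrix (∀ i, Fin (n i)) (∀ i, Fin (n i)) ℂ) :=
  ⟨tensorPi fun i => (A i : Matrix (Fin (n i)) (Fin (n i)) ℂ), by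
    show Matrix.IsHermitian _
    ext x y
    simp only [Matrix.conjTranspose_apply, tensorPi, Matrix.of_apply, star_prod]
    exact Finset.prod_congr rfl fun i _ => by
      rw [← Matrix.conjTranspose_apply, ← Matrix.star_eq_conjTranspose, (A i).property]⟩

/-- The set of pure product states `⊗_{i=1}^k P_{n_i}` inside `H_N`. -/
def PureTensor {k : ℕ} (n : Fin k → ℕ) :
    Set (selfAdjoint (Matrix (∀ i, Fin (n i)) (∀ i, Fin (n i)) ℂ)) :=
  {C | ∃ Q : ∀ i, Matrix (Fin (n i)) (Fin (n i)) ℂ, (∀ i, IsPureState (Q i)) ∧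
    (C : Matrix (∀ i, Fin (n i)) (∀ i, Fin (n i)) ℂ) = tensorPi Q}



open scoped ComplexOrder

/-! ### Pure states and diagonalisation -/

lemma unitary_conj_diagonal {m : ℕ} (W : Matrix (Fin m) (Fin m) ℂ) (d : Fin m → ℂ) :
    W * diagonal d * Wᴴ = ∑ k, d k • vecMulVec (fun i => W i k) (star (fun i => W i k)) := by
  ext i j
  rw [Matrix.mul_apply]
  simp only [Matrix.sum_apply, Matrix.smul_apply, vecMulVec_apply,
    Matrix.mul_diagonal, conjTranspose_apply, Pi.star_apply, smul_eq_mul]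
  exact Finset.sum_congr rfl fun k _ => by ring

lemma herm_diag {m : ℕ} {A : Matrix (Fin m) (Fin m) ℂ} (hA : A.IsHermitian) :
    ∃ W ∈ Matrix.unitaryGroup (Fin m) ℂ,
      A = W * diagonal (fun i => (hA.eigenvalues i : ℂ)) * Wᴴ := by
  refine ⟨hA.eigenvectorUnitary, hA.eigenvectorUnitary.2, ?_⟩
  have := hA.spectral_theorem
  rw [Unitary.conjStarAlgAut_apply] at this
  exact this

lemma unitary_col {m : ℕ} {W : Matrix (Fin m) (Fin m) ℂ}
    (hW : W ∈ Matrix.unitaryGroup (Fin m) ℂ) (k : Fin m) :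
    star (fun i => W i k) ⬝ᵥ (fun i => W i k) = 1 := by
  have h := congrFun (congrFun (Matrix.mem_unitaryGroup_iff'.1 hW) k) k
  rw [Matrix.one_apply_eq, Matrix.mul_apply] at h
  simpa [dotProduct, Matrix.star_apply] using h

lemma pure_of_vec {m : ℕ} {v : Fin m → ℂ} (hv : star v ⬝ᵥ v = 1) :
    IsPureState (vecMulVec v (star v)) := by
  have ht : (vecMulVec v (star v)).trace = 1 := by
    rw [trace_vecMulVec, dotProduct_comm]; exact hv
  refine ⟨(posSemidef_vecMulVec_self_star v).1, le_antisymm (rank_vecMulVec_le _ _) ?_, ht⟩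
  rw [Nat.one_le_iff_ne_zero]
  intro h0
  have hH : (vecMulVec v (star v)).IsHermitian := (posSemidef_vecMulVec_self_star v).1
  rw [hH.rank_eq_card_non_zero_eigs, Fintype.card_eq_zero_iff] at h0
  have h00 : hH.eigenvalues = 0 := funext fun i => by
    by_contra hne
    exact h0.elim ⟨i, hne⟩
  rw [hH.eigenvalues_eq_zero_iff] at h00
  rw [h00] at ht
  simp at ht

lemma pure_vec {m : ℕ} {A : Matrix (Fin m) (Fin m) ℂ} (h : IsPureState A) :
    ∃ v : Fin m → ℂ, star v ⬝ᵥ v = 1 ∧ A = vecMulVec v (star v) := by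
  obtain ⟨hA, hr, ht⟩ := h
  obtain ⟨W, hW, hAW⟩ := herm_diag hA
  have hc := hA.rank_eq_card_non_zero_eigs
  rw [hr] at hc
  obtain ⟨⟨k, hk⟩, huniq⟩ := Fintype.card_eq_one_iff.1 hc.symm
  have hz : ∀ j, j ≠ k → hA.eigenvalues j = 0 := by
    intro j hj
    by_contra hne
    exact hj (congrArg Subtype.val (huniq ⟨j, hne⟩))
  have ht' := hA.trace_eq_sum_eigenvalues
  rw [ht, Finset.sum_eq_single k (fun j _ hj => by simp [hz j hj]) (by simp)] at ht'
  refine ⟨fun i => W i k, unitary_col hW k, ?_⟩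
  rw [unitary_conj_diagonal, Finset.sum_eq_single k (fun j _ hj => by simp [hz j hj]) (by simp)]
    at hAW
  refine hAW.trans ?_
  have ht2 : (hA.eigenvalues k : ℂ) = 1 := ht'.symm
  rw [ht2, one_smul]

lemma pure_sq {m : ℕ} {A : Matrix (Fin m) (Fin m) ℂ} (h : IsPureState A) : A * A = A := by
  obtain ⟨v, hv, rfl⟩ := pure_vec h
  rw [vecMulVec_mul_vecMulVec, hv, one_smul]

lemma pure_span {m : ℕ} :
    Submodule.span ℂ {A : Matrix (Fin m) (Fin m) ℂ | IsPureState A} = ⊤ := by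
  rw [eq_top_iff, ← span_selfAdjoint, Submodule.span_le]
  intro A hA
  have hA' : A.IsHermitian := hA
  obtain ⟨W, hW, hAW⟩ := herm_diag hA'
  rw [hAW, unitary_conj_diagonal]
  exact Submodule.sum_mem _ fun k _ => Submodule.smul_mem _ _ <|
    Submodule.subset_span (pure_of_vec (unitary_col hW k))

/-! ### Linear maps preserving pure states -/

lemma pres_trace {m n : ℕ} (Φ : Matrix (Fin m) (Fin m) ℂ →ₗ[ℂ] Matrix (Fin n) (Fin n) ℂ)
    (hP : ∀ A, IsPureState A → IsPureState (Φ A)) (X : Matrix (Fin m) (Fin m) ℂ) :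
    (Φ X).trace = X.trace := by
  have : (Matrix.traceLinearMap (Fin n) ℂ ℂ).comp Φ = Matrix.traceLinearMap (Fin m) ℂ ℂ := by
    apply LinearMap.ext_on pure_span
    intro A hA
    simp [(hP A hA).2.2, hA.2.2]
  simpa using LinearMap.congr_fun this X

lemma pres_herm {m n : ℕ} (Φ : Matrix (Fin m) (Fin m) ℂ →ₗ[ℂ] Matrix (Fin n) (Fin n) ℂ)
    (hP : ∀ A, IsPureState A → IsPureState (Φ A)) {X : Matrix (Fin m) (Fin m) ℂ}
    (hX : X.IsHermitian) : (Φ X).IsHermitian := by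
  obtain ⟨W, hW, h⟩ := herm_diag hX
  rw [h, unitary_conj_diagonal, map_sum]
  refine isSelfAdjoint_sum _ fun k _ => ?_
  rw [map_smul]
  have := (hP _ (pure_of_vec (unitary_col hW k))).1
  refine IsSelfAdjoint.smul ?_ this
  simp [isSelfAdjoint_iff]

lemma pres_psd {m n : ℕ} (Φ : Matrix (Fin m) (Fin m) ℂ →ₗ[ℂ] Matrix (Fin n) (Fin n) ℂ)
    (hP : ∀ A, IsPureState A → IsPureState (Φ A)) {X : Matrix (Fin m) (Fin m) ℂ}
    (hX : X.PosSemidef) : (Φ X).PosSemidef := by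
  obtain ⟨W, hW, h⟩ := herm_diag hX.1
  rw [h, unitary_conj_diagonal, map_sum]
  refine posSemidef_sum _ fun k _ => ?_
  rw [map_smul]
  obtain ⟨v, hv, hv'⟩ := pure_vec (hP _ (pure_of_vec (unitary_col hW k)))
  rw [hv']
  refine (posSemidef_vecMulVec_self_star v).smul ?_
  have := hX.eigenvalues_nonneg k
  exact_mod_cast this

lemma pres_ge_one {m n : ℕ} (Φ : Matrix (Fin m) (Fin m) ℂ →ₗ[ℂ] Matrix (Fin n) (Fin n) ℂ)
    (hP : ∀ A, IsPureState A → IsPureState (Φ A))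
    (hS : ∀ B, IsPureState B → ∃ A, IsPureState A ∧ Φ A = B) :
    (Φ 1 - 1).PosSemidef := by
  refine PosSemidef.of_dotProduct_mulVec_nonneg ((pres_herm Φ hP isHermitian_one).sub isHermitian_one) ?_
  have unit : ∀ y : Fin n → ℂ, star y ⬝ᵥ y = 1 → 0 ≤ star y ⬝ᵥ ((Φ 1 - 1) *ᵥ y) := by
    intro y hy
    obtain ⟨A, hA, hAy⟩ := hS _ (pure_of_vec hy)
    have h1 : (1 - A).PosSemidef := by
      have := posSemidef_conjTranspose_mul_self (1 - A)
      rw [conjTranspose_sub, conjTranspose_one, hA.1.eq] at this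
      have e : (1 - A) * (1 - A) = 1 - A := by
        rw [sub_mul, mul_sub, mul_sub, pure_sq hA]; simp
      rwa [e] at this
    have h2 := (pres_psd Φ hP h1).dotProduct_mulVec_nonneg y
    rw [map_sub, hAy, sub_mulVec, vecMulVec_mulVec, hy] at h2
    simpa [sub_mulVec] using h2
  intro y
  by_cases hy : y = 0
  · simp [hy]
  have hpos : 0 < star y ⬝ᵥ y := dotProduct_star_self_pos_iff.2 hy
  obtain ⟨r, hr, hry⟩ : ∃ r : ℝ, 0 < r ∧ star y ⬝ᵥ y = r := by
    rw [Complex.pos_iff] at hpos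
    exact ⟨(star y ⬝ᵥ y).re, hpos.1, by apply Complex.ext <;> simp [hpos.2.symm]⟩
  obtain ⟨s, hs, hs2⟩ : ∃ s : ℝ, 0 < s ∧ s * s = r := ⟨√r, Real.sqrt_pos.2 hr, Real.mul_self_sqrt hr.le⟩
  have hs0 : (s : ℂ) ≠ 0 := by exact_mod_cast hs.ne'
  have hy' : y = (s : ℂ) • ((s : ℂ)⁻¹ • y) := by rw [smul_smul, mul_inv_cancel₀ hs0, one_smul]
  have := unit ((s : ℂ)⁻¹ • y) (by
    simp only [star_smul, smul_dotProduct, dotProduct_smul, hry, ← hs2]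
    simp
    field_simp)
  rw [hy']
  generalize ((s : ℂ)⁻¹ • y) = z at this
  simp only [star_smul, mulVec_smul, smul_dotProduct, dotProduct_smul, smul_eq_mul]
  simp only [Complex.star_def, Complex.conj_ofReal]
  have hs' : (0 : ℂ) ≤ s := by exact_mod_cast hs.le
  exact mul_nonneg hs' (mul_nonneg hs' this)

lemma pres_dim {m n : ℕ} (Φ : Matrix (Fin m) (Fin m) ℂ →ₗ[ℂ] Matrix (Fin n) (Fin n) ℂ)
    (hP : ∀ A, IsPureState A → IsPureState (Φ A))
    (hS : ∀ B, IsPureState B → ∃ A, IsPureState A ∧ Φ A = B) : n ≤ m := by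
  have := (pres_ge_one Φ hP hS).trace_nonneg
  rw [trace_sub, pres_trace Φ hP] at this
  simp only [trace_one, Fintype.card_fin, sub_nonneg] at this
  exact_mod_cast this

lemma pres_one {m : ℕ} (Φ : Matrix (Fin m) (Fin m) ℂ →ₗ[ℂ] Matrix (Fin m) (Fin m) ℂ)
    (hP : ∀ A, IsPureState A → IsPureState (Φ A))
    (hS : ∀ B, IsPureState B → ∃ A, IsPureState A ∧ Φ A = B) : Φ 1 = 1 := by
  have := (pres_ge_one Φ hP hS).trace_eq_zero_iff
  rw [trace_sub, pres_trace Φ hP, sub_self] at this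
  exact sub_eq_zero.1 (this.1 rfl)

lemma pres_diag {m : ℕ} (Φ : Matrix (Fin m) (Fin m) ℂ →ₗ[ℂ] Matrix (Fin m) (Fin m) ℂ)
    (hP : ∀ A, IsPureState A → IsPureState (Φ A)) (h1 : Φ 1 = 1)
    {W : Matrix (Fin m) (Fin m) ℂ} (hW : W ∈ Matrix.unitaryGroup (Fin m) ℂ) :
    ∃ V ∈ Matrix.unitaryGroup (Fin m) ℂ, ∀ d : Fin m → ℂ,
      Φ (W * diagonal d * Wᴴ) = V * diagonal d * Vᴴ := by
  choose a ha ha' using fun k => pure_vec (hP _ (pure_of_vec (unitary_col hW k)))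
  have key : ∀ d : Fin m → ℂ,
      Φ (W * diagonal d * Wᴴ) = (Matrix.of fun i k => a k i) * diagonal d * (Matrix.of fun i k => a k i)ᴴ := by
    intro d
    rw [unitary_conj_diagonal, unitary_conj_diagonal, map_sum]
    refine Finset.sum_congr rfl fun k _ => ?_
    rw [map_smul, ha' k]
    rfl
  refine ⟨Matrix.of fun i k => a k i, ?_, key⟩
  have := key (fun _ => 1)
  rw [diagonal_one, mul_one, mul_one] at this
  rw [Matrix.mem_unitaryGroup_iff, star_eq_conjTranspose, ← this, ← star_eq_conjTranspose, Matrix.mem_unitaryGroup_iff.1 hW, h1]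

lemma pres_sq_herm {m : ℕ} (Φ : Matrix (Fin m) (Fin m) ℂ →ₗ[ℂ] Matrix (Fin m) (Fin m) ℂ)
    (hP : ∀ A, IsPureState A → IsPureState (Φ A)) (h1 : Φ 1 = 1)
    {A : Matrix (Fin m) (Fin m) ℂ} (hA : A.IsHermitian) : Φ (A * A) = Φ A * Φ A := by
  obtain ⟨W, hW, h⟩ := herm_diag hA
  obtain ⟨V, hV, hd⟩ := pres_diag Φ hP h1 hW
  have aux : ∀ (U : Matrix (Fin m) (Fin m) ℂ), U ∈ Matrix.unitaryGroup (Fin m) ℂ → ∀ d : Fin m → ℂ,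
      (U * diagonal d * Uᴴ) * (U * diagonal d * Uᴴ) = U * diagonal (fun i => d i * d i) * Uᴴ := by
    intro U hU d
    have hU' : Uᴴ * U = 1 := Matrix.mem_unitaryGroup_iff'.1 hU
    rw [← diagonal_mul_diagonal]
    calc _ = U * diagonal d * (Uᴴ * U) * diagonal d * Uᴴ := by simp only [mul_assoc]
      _ = _ := by rw [hU']; simp only [mul_assoc, one_mul]
  rw [h, aux W hW, hd, hd, aux V hV]

lemma herm_decomp {m : ℕ} (X : Matrix (Fin m) (Fin m) ℂ) :
    ∃ A B : Matrix (Fin m) (Fin m) ℂ, A.IsHermitian ∧ B.IsHermitian ∧ X = A + Complex.I • B :=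
  ⟨_, _, (realPart X).2, (imaginaryPart X).2, (realPart_add_I_smul_imaginaryPart X).symm⟩

lemma pres_star {m : ℕ} (Φ : Matrix (Fin m) (Fin m) ℂ →ₗ[ℂ] Matrix (Fin m) (Fin m) ℂ)
    (hP : ∀ A, IsPureState A → IsPureState (Φ A)) (X : Matrix (Fin m) (Fin m) ℂ) :
    Φ Xᴴ = (Φ X)ᴴ := by
  obtain ⟨A, B, hA, hB, rfl⟩ := herm_decomp X
  simp only [conjTranspose_add, conjTranspose_smul, map_add, map_smul, hA.eq, hB.eq,
    (pres_herm Φ hP hA).eq, (pres_herm Φ hP hB).eq]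

lemma pres_jordan {m : ℕ} (Φ : Matrix (Fin m) (Fin m) ℂ →ₗ[ℂ] Matrix (Fin m) (Fin m) ℂ)
    (hP : ∀ A, IsPureState A → IsPureState (Φ A)) (h1 : Φ 1 = 1)
    (X Y : Matrix (Fin m) (Fin m) ℂ) : Φ (X * Y + Y * X) = Φ X * Φ Y + Φ Y * Φ X := by
  have pol : ∀ X Y : Matrix (Fin m) (Fin m) ℂ, Φ (X * X) = Φ X * Φ X → Φ (Y * Y) = Φ Y * Φ Y →
      Φ ((X + Y) * (X + Y)) = Φ (X + Y) * Φ (X + Y) →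
      Φ (X * Y + Y * X) = Φ X * Φ Y + Φ Y * Φ X := by
    intro X Y hX hY hXY
    have e1 : X * Y + Y * X = (X + Y) * (X + Y) - X * X - Y * Y := by noncomm_ring
    rw [e1, map_sub, map_sub, hX, hY, hXY, map_add]
    noncomm_ring
  have sq : ∀ X : Matrix (Fin m) (Fin m) ℂ, Φ (X * X) = Φ X * Φ X := by
    intro X
    obtain ⟨A, B, hA, hB, rfl⟩ := herm_decomp X
    have hAB := pol A B (pres_sq_herm Φ hP h1 hA) (pres_sq_herm Φ hP h1 hB)
      (pres_sq_herm Φ hP h1 (hA.add hB))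
    have e : ∀ A B : Matrix (Fin m) (Fin m) ℂ, (A + Complex.I • B) * (A + Complex.I • B) =
        A * A - B * B + Complex.I • (A * B + B * A) := by
      intro A B
      simp only [add_mul, mul_add, smul_mul_assoc, mul_smul_comm, smul_smul, Complex.I_mul_I, smul_add]
      rw [neg_smul, one_smul]; abel
    rw [map_add, map_smul, e, e, map_add, map_sub, map_smul, hAB, pres_sq_herm Φ hP h1 hA,
      pres_sq_herm Φ hP h1 hB]
  exact pol X Y (sq X) (sq Y) (sq _)


/-! ### Combinatorics of Hamming adjacency -/

section Hamming

variable {ι : Type*} [Fintype ι] [DecidableEq ι] {X : ι → Type*}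

/-- `a` and `b` differ exactly in coordinate `i`. -/
def HAdj (a b : ∀ i, X i) (i : ι) : Prop := a i ≠ b i ∧ ∀ l, l ≠ i → a l = b l

lemma HAdj.symm' {a b : ∀ i, X i} {i : ι} (h : HAdj a b i) : HAdj b a i :=
  ⟨h.1.symm, fun l hl => (h.2 l hl).symm⟩

lemma HAdj.unique {a b : ∀ i, X i} {i j : ι} (h : HAdj a b i) (h' : HAdj a b j) : i = j := by
  by_contra hne
  exact h.1 (h'.2 i hne)

lemma update_induction {P : (∀ i, X i) → Prop} (hP : ∀ a i x, P a → P (Function.update a i x))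
    (a b : ∀ i, X i) (ha : P a) : P b := by
  have : ∀ s : Finset ι, P (s.piecewise b a) := by
    intro s
    induction s using Finset.induction_on with
    | empty => simpa using ha
    | insert j s _ ih => rw [Finset.piecewise_insert]; exact hP _ _ _ ih
  simpa using this Finset.univ

lemma hamming_dir (f : (∀ i, X i) ≃ (∀ i, X i))
    (h : ∀ a b i, HAdj a b i → ∃ j, HAdj (f a) (f b) j)
    (h' : ∀ a b i, HAdj a b i → ∃ j, HAdj (f.symm a) (f.symm b) j)
    [∀ i, Nontrivial (X i)] (i : ι) :
    ∃ j, ∀ a b, HAdj a b i → HAdj (f a) (f b) j := by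
  have line : ∀ a b c j, HAdj a b i → HAdj a c i → HAdj (f a) (f b) j → HAdj (f a) (f c) j := by
    intro a b c j hab hac hj
    by_cases hbc : b = c
    · rwa [← hbc]
    have hbc' : HAdj b c i := by
      refine ⟨fun e => hbc (funext fun l => ?_), fun l hl => (hab.2 l hl).symm.trans (hac.2 l hl)⟩
      by_cases hl : l = i
      · subst hl; exact e
      · exact (hab.2 l hl).symm.trans (hac.2 l hl)
    obtain ⟨j', hj'⟩ := h a c i hac
    obtain ⟨l, hl⟩ := h b c i hbc'
    by_cases hjj : j' = j
    · rwa [← hjj]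
    exfalso
    have e1 : f b j ≠ f c j := by rw [← hj'.2 j (Ne.symm hjj)]; exact hj.1.symm
    have e2 : f b j' ≠ f c j' := by rw [← hj.2 j' hjj]; exact hj'.1
    have l1 : j = l := by by_contra hne; exact e1 (hl.2 _ hne)
    have l2 : j' = l := by by_contra hne; exact e2 (hl.2 _ hne)
    exact hjj (l2.trans l1.symm)
  -- shifting a base point in another coordinate gives a different direction
  have shift : ∀ a b c i' j j1, i' ≠ i → HAdj a b i → HAdj a c i' → HAdj (f a) (f b) j →
      HAdj (f a) (f c) j1 → j1 ≠ j := by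
    intro a b c i' j j1 hii hab hac hj hj1 e
    subst e
    have hbc : b ≠ c := by
      rintro rfl
      exact hab.1 (hac.2 i hii.symm)
    have : HAdj (f b) (f c) j1 := by
      refine ⟨fun e => hbc (f.injective (funext fun l => ?_)), fun l hl => (hj.2 l hl).symm.trans (hj1.2 l hl)⟩
      by_cases hl : l = j1
      · subst hl; exact e
      · exact (hj.2 l hl).symm.trans (hj1.2 l hl)
    obtain ⟨l, hl⟩ := h' _ _ _ this
    simp only [Equiv.symm_apply_apply] at hl
    have e1 : b i ≠ c i := by rw [← hac.2 i hii.symm]; exact hab.1.symm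
    have e2 : b i' ≠ c i' := by rw [← hab.2 i' hii]; exact hac.1
    have l1 : i = l := by by_contra hne; exact e1 (hl.2 _ hne)
    have l2 : i' = l := by by_contra hne; exact e2 (hl.2 _ hne)
    exact hii (l2.trans l1.symm)
  by_cases hne : Nonempty (∀ i, X i)
  swap
  · exact ⟨i, fun a => (hne ⟨a⟩).elim⟩
  obtain ⟨a0⟩ := hne
  have ex : ∀ a : ∀ i, X i, ∃ b, HAdj a b i := by
    intro a
    obtain ⟨x, hx⟩ := exists_ne (a i)
    exact ⟨Function.update a i x, by simpa using hx.symm, fun l hl => by simp [hl]⟩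
  obtain ⟨b0, hb0⟩ := ex a0
  obtain ⟨j, hj⟩ := h _ _ _ hb0
  refine ⟨j, fun a => ?_⟩
  refine update_induction (P := fun a => ∀ b, HAdj a b i → HAdj (f a) (f b) j) ?_ a0 a
    (fun b hb => line _ _ _ _ hb0 hb hj)
  intro a i' x ih b' hb'
  by_cases hx : a i' = x
  · rw [← hx, Function.update_eq_self] at hb' ⊢
    exact ih _ hb'
  have haa' : HAdj a (Function.update a i' x) i' := ⟨by simpa using hx, fun l hl => by simp [hl]⟩
  by_cases hii : i' = i
  · subst hii
    exact line _ _ _ _ haa'.symm' hb' (ih _ haa').symm'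
  · set a' := Function.update a i' x with ha'
    let b := Function.update b' i' (a i')
    have hab : HAdj a b i := by
      refine ⟨?_, fun l hl => ?_⟩
      · have := hb'.1
        simp only [b, Function.update_of_ne (Ne.symm hii)]
        rwa [← haa'.2 i (Ne.symm hii)] at this
      · by_cases hl' : l = i'
        · subst hl'; simp [b]
        · simp only [b, Function.update_of_ne hl']
          rw [haa'.2 l hl', hb'.2 l hl]
    have hbb' : HAdj b b' i' := by
      refine ⟨?_, fun l hl => by simp [b, hl]⟩
      rw [← hb'.2 i' hii]
      simpa [b] using haa'.1
    have hj0 := ih b hab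
    obtain ⟨j1, hj1⟩ := h _ _ _ haa'
    obtain ⟨j2, hj2⟩ := h _ _ _ hbb'
    have n1 := shift _ _ _ _ _ _ hii hab haa' hj0 hj1
    have n2 := shift _ _ _ _ _ _ hii hab.symm' hbb' hj0.symm' hj2
    obtain ⟨j', hj'⟩ := h _ _ _ hb'
    have : f a' j ≠ f b' j := by
      rw [← hj1.2 j n1.symm, ← hj2.2 j n2.symm]; exact hj0.1
    have : j = j' := by by_contra hne; exact this (hj'.2 _ hne)
    rwa [this]

lemma hamming_main (f : (∀ i, X i) ≃ (∀ i, X i))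
    (h : ∀ a b i, HAdj a b i → ∃ j, HAdj (f a) (f b) j)
    (h' : ∀ a b i, HAdj a b i → ∃ j, HAdj (f.symm a) (f.symm b) j)
    [∀ i, Nontrivial (X i)] :
    ∃ τ : Equiv.Perm ι, ∀ j a b, a (τ j) = b (τ j) → f a j = f b j := by
  choose σ hσ using hamming_dir f h h'
  choose τ hτ using hamming_dir f.symm h' (by simpa using h)
  have ex : ∀ i, ∃ a b : ∀ i, X i, HAdj a b i := by
    intro i
    have a : ∀ i, X i := fun i => (inferInstance : Nonempty (X i)).some
    obtain ⟨x, hx⟩ := exists_ne (a i)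
    exact ⟨a, Function.update a i x, by simpa using hx.symm, fun l hl => by simp [hl]⟩
  have h1 : ∀ i, τ (σ i) = i := by
    intro i
    obtain ⟨a, b, hab⟩ := ex i
    have := hτ _ _ _ (hσ _ _ _ hab)
    simp only [Equiv.symm_apply_apply] at this
    exact this.unique hab
  have h2 : ∀ i, σ (τ i) = i := by
    intro i
    obtain ⟨a, b, hab⟩ := ex i
    have := hσ _ _ _ (hτ _ _ _ hab)
    simp only [Equiv.apply_symm_apply] at this
    exact this.unique hab
  refine ⟨⟨τ, σ, h2, h1⟩, fun j a b hab => ?_⟩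
  simp only [Equiv.coe_fn_mk] at hab
  have := update_induction (P := fun c => f (Function.update c (τ j) (a (τ j))) j = f a j) ?_ a b
    (by simp)
  · rw [hab, Function.update_eq_self] at this
    exact this.symm
  intro c i x hc
  by_cases hi : i = τ j
  · subst hi; simpa using hc
  rw [Function.update_comm hi]
  rw [← hc]
  set d := Function.update c (τ j) (a (τ j))
  by_cases hx : d i = x
  · rw [← hx, Function.update_eq_self]
  have : HAdj (Function.update d i x) d i := ⟨by simpa using Ne.symm hx, fun l hl => by simp [hl]⟩
  refine (hσ _ _ _ this).2 j ?_
  rintro rfl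
  exact hi (h1 i).symm

end Hamming


/-! ### Jordan maps fixing the diagonal -/

lemma cocycle_split {m : ℕ} (γ : Fin m → Fin m → ℂ) (hd : ∀ i, γ i i = 1)
    (hs : ∀ i j, γ j i = star (γ i j)) (hn : ∀ i j, i ≠ j → γ i j * γ j i = 1)
    (ht : ∀ i j k, i ≠ j → j ≠ k → i ≠ k → γ i k = γ i j * γ j k) :
    ∃ d : Fin m → ℂ, (∀ i, d i * star (d i) = 1) ∧ ∀ i j, γ i j = d i * star (d j) := by
  have ht' : ∀ i j k, γ i k = γ i j * γ j k := by
    intro i j k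
    by_cases h1 : i = j
    · subst h1; simp [hd]
    by_cases h2 : j = k
    · subst h2; simp [hd]
    by_cases h3 : i = k
    · subst h3; rw [hd, hn _ _ h1]
    exact ht i j k h1 h2 h3
  rcases Nat.eq_zero_or_pos m with rfl | hm
  · exact ⟨fun _ => 1, fun i => i.elim0, fun i => i.elim0⟩
  refine ⟨fun i => γ i ⟨0, hm⟩, fun i => ?_, fun i j => ?_⟩
  · rw [← hs, ← ht', hd]
  · rw [← hs, ← ht']

lemma diagonal_unit_mem {m : ℕ} {d : Fin m → ℂ} (hd : ∀ i, d i * star (d i) = 1) :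
    diagonal d ∈ Matrix.unitaryGroup (Fin m) ℂ := by
  rw [Matrix.mem_unitaryGroup_iff, star_eq_conjTranspose, diagonal_conjTranspose,
    diagonal_mul_diagonal, ← diagonal_one]
  congr 1
  ext i
  exact hd i

lemma jordan_form {m : ℕ} (Θ : Matrix (Fin m) (Fin m) ℂ →ₗ[ℂ] Matrix (Fin m) (Fin m) ℂ)
    (hJ : ∀ X Y, Θ (X * Y + Y * X) = Θ X * Θ Y + Θ Y * Θ X)
    (hS : ∀ X, Θ Xᴴ = (Θ X)ᴴ) (hD : ∀ d, Θ (diagonal d) = diagonal d) :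
    ∃ U ∈ Matrix.unitaryGroup (Fin m) ℂ,
      (∀ X, Θ X = U * X * Uᴴ) ∨ (∀ X, Θ X = U * Xᵀ * Uᴴ) := by
  have hdiag : ∀ i : Fin m, single i i (1 : ℂ) = diagonal (Pi.single i 1) := fun i => by
    rw [diagonal_single]
  -- entries
  have ent : ∀ i j p q (d : Fin m → ℂ),
      (d p + d q) * Θ (single i j 1) p q = (d i + d j) * Θ (single i j 1) p q := by
    intro i j p q d
    have h := hJ (diagonal d) (single i j 1)
    have e : diagonal d * single i j (1 : ℂ) + single i j 1 * diagonal d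
        = (d i + d j) • single i j 1 := by
      ext a b
      simp only [Matrix.add_apply, Matrix.diagonal_mul, Matrix.mul_diagonal, Matrix.smul_apply,
        smul_eq_mul, Matrix.single_apply]
      split_ifs with h
      · rw [h.1, h.2]; ring
      · ring
    rw [e, map_smul, hD] at h
    have h' := congrFun (congrFun h p) q
    simp only [Matrix.add_apply, Matrix.diagonal_mul, Matrix.mul_diagonal, Matrix.smul_apply,
        smul_eq_mul] at h'
    rw [h']; ring
  set α : Fin m → Fin m → ℂ := fun i j => Θ (single i j 1) i j with hα
  set β : Fin m → Fin m → ℂ := fun i j => Θ (single i j 1) j i with hβ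
  have hαd : ∀ i, α i i = 1 := by intro i; simp [hα, hdiag, hD]
  have hβd : ∀ i, β i i = 1 := by intro i; simp [hβ, hdiag, hD]
  have star1 : ∀ i j : Fin m, single j i (1 : ℂ) = (single i j 1)ᴴ := by intro i j; simp
  have hαs : ∀ i j, α j i = star (α i j) := by
    intro i j
    simp only [hα]; rw [star1 i j, hS]; rfl
  have hβs : ∀ i j, β j i = star (β i j) := by
    intro i j
    simp only [hβ]; rw [star1 i j, hS]; rfl
  have form : ∀ i j, i ≠ j → Θ (single i j 1) = single i j (α i j) + single j i (β i j) := by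
    intro i j hij
    ext p q
    by_cases hX : Θ (single i j 1) p q = 0
    · rw [hX]
      simp only [Matrix.add_apply, Matrix.single_apply]
      have e1 : (if i = p ∧ j = q then α i j else 0) = 0 := by
        split_ifs with h
        · rw [← hX, ← h.1, ← h.2]
        · rfl
      have e2 : (if j = p ∧ i = q then β i j else 0) = 0 := by
        split_ifs with h
        · rw [← hX, ← h.1, ← h.2]
        · rfl
      rw [e1, e2, add_zero]
    · have h1 := mul_right_cancel₀ hX (ent i j p q (Pi.single i 1))
      have h2 := mul_right_cancel₀ hX (ent i j p q (Pi.single j 1))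
      have hji := hij.symm
      simp only [Pi.single_apply, if_true, if_neg hij, if_neg hji] at h1 h2
      by_cases hp : p = i
      · subst hp
        rw [if_neg hij] at h2
        have hq : q = j := by
          by_contra hq
          simp [hq] at h2
        subst hq
        simp [hα, hij, hij.symm]
      · rw [if_neg hp] at h1
        have hq : q = i := by
          by_contra hq
          simp [hq] at h1
        subst hq
        rw [if_neg hij] at h2
        have hp : p = j := by
          by_contra hp
          simp [hp] at h2
        subst hp
        simp [hβ, hij, hij.symm]
  have hαβ : ∀ i j, i ≠ j → α i j * β i j = 0 := by
    intro i j hij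
    have h := congrFun (congrFun (hJ (single i j 1) (single i j 1)) i) i
    rw [form i j hij] at h
    simp [add_mul, mul_add, hij, hij.symm] at h
    have h' : 2 * (α i j * β i j) = 0 := by rw [two_mul]; exact h.symm
    simpa using h'
  have hnorm : ∀ i j, i ≠ j → α i j * α j i + β i j * β j i = 1 := by
    intro i j hij
    have h := congrFun (congrFun (hJ (single i j 1) (single j i 1)) i) i
    have e : Θ (single i j 1 * single j i 1 + single j i 1 * single i j 1)
        = single i i 1 + single j j 1 := by
      simp [hdiag, hD]
    rw [e, form i j hij, form j i hij.symm] at h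
    simp [add_mul, mul_add, hij, hij.symm] at h
    rw [h]; ring
  have htri : ∀ i j k, i ≠ j → j ≠ k → i ≠ k → α i k = α i j * α j k ∧ β i k = β i j * β j k := by
    intro i j k hij hjk hik
    have h := hJ (single i j 1) (single j k 1)
    have e : single i j (1 : ℂ) * single j k 1 + single j k 1 * single i j 1 = single i k 1 := by
      simp [hik.symm]
    rw [e, form i j hij, form j k hjk, form i k hik] at h
    constructor
    · have h' := congrFun (congrFun h i) k
      simp [add_mul, mul_add, hij, hij.symm, hjk, hjk.symm, hik, hik.symm] at h'
      exact h'
    · have h' := congrFun (congrFun h k) i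
      simp [add_mul, mul_add, hij, hij.symm, hjk, hjk.symm, hik, hik.symm] at h'
      rw [h']; ring
  have prop : ∀ i j, i ≠ j → α i j = 0 → ∀ k l, k ≠ l → α k l = 0 := by
    intro i j hij h0
    have s1 : ∀ k, k ≠ i → α i k = 0 := by
      intro k hk
      by_cases hkj : k = j
      · rw [hkj, h0]
      · rw [(htri i j k hij (Ne.symm hkj) hk.symm).1, h0, zero_mul]
    intro k l hkl
    by_cases hk : k = i
    · subst hk; exact s1 l hkl.symm
    · have : α k i = 0 := by rw [hαs i k, s1 k hk, star_zero]
      by_cases hl : l = i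
      · rw [hl, this]
      · rw [(htri k i l hk (Ne.symm hl) hkl).1, this, zero_mul]
  by_cases hcase : ∀ i j, i ≠ j → β i j = 0
  · obtain ⟨d, hd1, hd2⟩ := cocycle_split α hαd hαs
      (fun i j hij => by simpa [hcase i j hij] using hnorm i j hij)
      (fun i j k h1 h2 h3 => (htri i j k h1 h2 h3).1)
    refine ⟨diagonal d, diagonal_unit_mem hd1, Or.inl fun X => ?_⟩
    have : Θ = (LinearMap.mulRight ℂ (diagonal d)ᴴ).comp (LinearMap.mulLeft ℂ (diagonal d)) := by
      apply Matrix.ext_linearMap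
      intro i j
      ext : 1
      change Θ (single i j 1) = diagonal d * single i j 1 * (diagonal d)ᴴ
      ext p q
      have hf : Θ (single i j 1) = single i j (α i j) := by
        by_cases hij : i = j
        · subst hij; rw [hαd, hdiag, hD]
        · rw [form i j hij, hcase i j hij]; simp
      rw [hf, diagonal_conjTranspose, Matrix.mul_diagonal, Matrix.diagonal_mul, Matrix.single_apply,
        Matrix.single_apply, hd2]
      split_ifs with h
      · rw [← h.1, ← h.2]; simp
      · simp
    rw [this]; simp
  · push Not at hcase
    obtain ⟨i0, j0, hij0, hb0⟩ := hcase
    have ha0 : α i0 j0 = 0 := (mul_eq_zero.1 (hαβ i0 j0 hij0)).resolve_right hb0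
    have hcase := prop i0 j0 hij0 ha0
    obtain ⟨d, hd1, hd2⟩ := cocycle_split β hβd hβs
      (fun i j hij => by simpa [hcase i j hij] using hnorm i j hij)
      (fun i j k h1 h2 h3 => (htri i j k h1 h2 h3).2)
    refine ⟨diagonal (star d), diagonal_unit_mem fun i => by simpa [mul_comm] using hd1 i, Or.inr fun X => ?_⟩
    have : Θ = ((LinearMap.mulRight ℂ (diagonal (star d))ᴴ).comp
        (LinearMap.mulLeft ℂ (diagonal (star d)))).comp
        (Matrix.transposeLinearEquiv (Fin m) (Fin m) ℂ ℂ).toLinearMap := by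
      apply Matrix.ext_linearMap
      intro i j
      ext : 1
      change Θ (single i j 1) = diagonal (star d) * (single i j 1)ᵀ * (diagonal (star d))ᴴ
      ext p q
      have hf : Θ (single i j 1) = single j i (β i j) := by
        by_cases hij : i = j
        · subst hij; rw [hβd, hdiag, hD]
        · rw [form i j hij, hcase i j hij]; simp
      rw [Matrix.transpose_single]
      rw [hf, diagonal_conjTranspose, Matrix.mul_diagonal, Matrix.diagonal_mul, Matrix.single_apply,
        Matrix.single_apply, hd2]
      split_ifs with h
      · rw [← h.1, ← h.2]; simp [mul_comm]
      · simp
    rw [this]; simp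

lemma wigner_form {m : ℕ} (Φ : Matrix (Fin m) (Fin m) ℂ →ₗ[ℂ] Matrix (Fin m) (Fin m) ℂ)
    (hP : ∀ A, IsPureState A → IsPureState (Φ A))
    (hS : ∀ B, IsPureState B → ∃ A, IsPureState A ∧ Φ A = B) :
    ∃ U ∈ Matrix.unitaryGroup (Fin m) ℂ,
      (∀ X, Φ X = U * X * Uᴴ) ∨ (∀ X, Φ X = U * Xᵀ * Uᴴ) := by
  have h1 := pres_one Φ hP hS
  obtain ⟨V, hV, hd⟩ := pres_diag Φ hP h1 (one_mem (Matrix.unitaryGroup (Fin m) ℂ))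
  have hV1 : Vᴴ * V = 1 := Matrix.mem_unitaryGroup_iff'.1 hV
  have hV2 : V * Vᴴ = 1 := Matrix.mem_unitaryGroup_iff.1 hV
  let Θ : Matrix (Fin m) (Fin m) ℂ →ₗ[ℂ] Matrix (Fin m) (Fin m) ℂ :=
    ((LinearMap.mulRight ℂ V).comp (LinearMap.mulLeft ℂ Vᴴ)).comp Φ
  have hΘ : ∀ X, Θ X = Vᴴ * Φ X * V := fun X => rfl
  have hΦ : ∀ X, Φ X = V * Θ X * Vᴴ := fun X => by
    rw [hΘ]
    calc Φ X = (V * Vᴴ) * Φ X * (V * Vᴴ) := by rw [hV2]; simp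
      _ = _ := by simp only [mul_assoc]
  obtain ⟨U, hU, h⟩ := jordan_form Θ
    (fun X Y => by
      rw [hΘ, hΘ, hΘ, pres_jordan Φ hP h1]
      have e : ∀ A B : Matrix (Fin m) (Fin m) ℂ, Vᴴ * A * V * (Vᴴ * B * V) = Vᴴ * (A * B) * V := by
        intro A B
        calc _ = Vᴴ * A * (V * Vᴴ) * B * V := by simp only [mul_assoc]
          _ = _ := by rw [hV2]; simp [mul_assoc]
      rw [e, e, mul_add, add_mul])
    (fun X => by
      rw [hΘ, hΘ, pres_star Φ hP, conjTranspose_mul, conjTranspose_mul, conjTranspose_conjTranspose, mul_assoc])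
    (fun d => by
      have := hd d
      rw [one_mul, conjTranspose_one, mul_one] at this
      rw [hΘ, this]
      calc _ = (Vᴴ * V) * diagonal d * (Vᴴ * V) := by simp only [mul_assoc]
        _ = _ := by rw [hV1]; simp)
  refine ⟨V * U, mul_mem hV hU, ?_⟩
  rcases h with h | h
  · left; intro X; rw [hΦ, h, conjTranspose_mul]; simp only [mul_assoc]
  · right; intro X; rw [hΦ, h, conjTranspose_mul]; simp only [mul_assoc]


/-! ### Tensor products -/

lemma tensorPi_mul {k : ℕ} {n : Fin k → ℕ} (A B : ∀ i, Matrix (Fin (n i)) (Fin (n i)) ℂ) :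
    tensorPi A * tensorPi B = tensorPi fun i => A i * B i := by
  ext x y
  simp only [tensorPi, Matrix.mul_apply, Matrix.of_apply, ← Finset.prod_mul_distrib]
  rw [Finset.prod_univ_sum, Fintype.piFinset_univ]

lemma tensorPi_trace {k : ℕ} {n : Fin k → ℕ} (A : ∀ i, Matrix (Fin (n i)) (Fin (n i)) ℂ) :
    (tensorPi A).trace = ∏ i, (A i).trace := by
  simp only [tensorPi, Matrix.trace, Matrix.diag_apply, Matrix.of_apply]
  rw [Finset.prod_univ_sum, Fintype.piFinset_univ]

lemma tensorPi_update_apply {k : ℕ} {n : Fin k → ℕ} (A : ∀ i, Matrix (Fin (n i)) (Fin (n i)) ℂ)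
    (i : Fin k) (X : Matrix (Fin (n i)) (Fin (n i)) ℂ) (x y : ∀ i, Fin (n i)) :
    tensorPi (Function.update A i X) x y =
      X (x i) (y i) * ∏ l ∈ Finset.univ.erase i, A l (x l) (y l) := by
  simp only [tensorPi, Matrix.of_apply]
  rw [← Finset.mul_prod_erase _ _ (Finset.mem_univ i), Function.update_self]
  congr 1
  refine Finset.prod_congr rfl fun l hl => ?_
  rw [Function.update_of_ne (Finset.ne_of_mem_erase hl)]

/-- The tensor product as a linear map of its `i`-th factor. -/
noncomputable def tensorLin {k : ℕ} {n : Fin k → ℕ} (A : ∀ i, Matrix (Fin (n i)) (Fin (n i)) ℂ)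
    (i : Fin k) : Matrix (Fin (n i)) (Fin (n i)) ℂ →ₗ[ℂ]
      Matrix (∀ i, Fin (n i)) (∀ i, Fin (n i)) ℂ where
  toFun X := tensorPi (Function.update A i X)
  map_add' X Y := by
    ext x y
    simp only [tensorPi_update_apply, Matrix.add_apply]
    ring
  map_smul' c X := by
    ext x y
    simp only [tensorPi_update_apply, Matrix.smul_apply, smul_eq_mul, RingHom.id_apply]
    ring

/-- The functional `T ↦ tr (T (⊗ W_i))`. -/
noncomputable def tensorFun {k : ℕ} {n : Fin k → ℕ} (W : ∀ i, Matrix (Fin (n i)) (Fin (n i)) ℂ) :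
    Matrix (∀ i, Fin (n i)) (∀ i, Fin (n i)) ℂ →ₗ[ℂ] ℂ :=
  (Matrix.traceLinearMap _ ℂ ℂ).comp (LinearMap.mulRight ℂ (tensorPi W))

lemma tensorFun_apply {k : ℕ} {n : Fin k → ℕ} (W A : ∀ i, Matrix (Fin (n i)) (Fin (n i)) ℂ) :
    tensorFun W (tensorPi A) = ∏ i, (A i * W i).trace := by
  simp only [tensorFun, LinearMap.comp_apply, LinearMap.mulRight_apply, tensorPi_mul,
    Matrix.traceLinearMap_apply, tensorPi_trace]

lemma tensorFun_one {k : ℕ} {n : Fin k → ℕ} (A : ∀ i, Matrix (Fin (n i)) (Fin (n i)) ℂ)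
    (hA : ∀ i, (A i).trace = 1) (j : Fin k) (W : Matrix (Fin (n j)) (Fin (n j)) ℂ) :
    tensorFun (Function.update (fun i => (1 : Matrix (Fin (n i)) (Fin (n i)) ℂ)) j W) (tensorPi A)
      = (A j * W).trace := by
  rw [tensorFun_apply, Finset.prod_eq_single j]
  · rw [Function.update_self]
  · intro l _ hl
    rw [Function.update_of_ne hl, mul_one, hA]
  · simp

lemma tensorFun_two {k : ℕ} {n : Fin k → ℕ} (A : ∀ i, Matrix (Fin (n i)) (Fin (n i)) ℂ)
    (hA : ∀ i, (A i).trace = 1) (j l : Fin k) (hjl : j ≠ l)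
    (W : Matrix (Fin (n j)) (Fin (n j)) ℂ) (W' : Matrix (Fin (n l)) (Fin (n l)) ℂ) :
    tensorFun (Function.update (Function.update
      (fun i => (1 : Matrix (Fin (n i)) (Fin (n i)) ℂ)) j W) l W') (tensorPi A)
      = (A j * W).trace * (A l * W').trace := by
  rw [tensorFun_apply, Finset.prod_eq_mul j l hjl]
  · rw [Function.update_self, Function.update_of_ne hjl, Function.update_self]
  · intro i _ hi
    rw [Function.update_of_ne hi.2, Function.update_of_ne hi.1, mul_one, hA]
  · simp
  · simp

/-- Partial trace onto the `j`-th factor. -/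
noncomputable def ptr {k : ℕ} (n : Fin k → ℕ) (j : Fin k) :
    Matrix (∀ i, Fin (n i)) (∀ i, Fin (n i)) ℂ →ₗ[ℂ] Matrix (Fin (n j)) (Fin (n j)) ℂ where
  toFun T := Matrix.of fun a b =>
    tensorFun (Function.update (fun i => (1 : Matrix (Fin (n i)) (Fin (n i)) ℂ)) j (single b a 1)) T
  map_add' X Y := by ext; simp
  map_smul' c X := by ext; simp

lemma ptr_tensorPi {k : ℕ} {n : Fin k → ℕ} (A : ∀ i, Matrix (Fin (n i)) (Fin (n i)) ℂ)
    (hA : ∀ i, (A i).trace = 1) (j : Fin k) : ptr n j (tensorPi A) = A j := by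
  ext a b
  simp only [ptr, LinearMap.coe_mk, AddHom.coe_mk, Matrix.of_apply]
  rw [tensorFun_one A hA]
  simp [Matrix.trace_mul_single]

lemma tensorPi_pure_inj {k : ℕ} {n : Fin k → ℕ} {A B : ∀ i, Matrix (Fin (n i)) (Fin (n i)) ℂ}
    (hA : ∀ i, IsPureState (A i)) (hB : ∀ i, IsPureState (B i)) (h : tensorPi A = tensorPi B) :
    A = B := by
  funext j
  rw [← ptr_tensorPi A (fun i => (hA i).2.2) j, h, ptr_tensorPi B (fun i => (hB i).2.2) j]

/-! ### Slices go to slices -/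

lemma pure_scale {m : ℕ} (w : Fin m → ℂ) (hw : w ≠ 0) :
    ∃ (c : ℝ) (z : Matrix (Fin m) (Fin m) ℂ), IsPureState z ∧
      vecMulVec w (star w) = (c : ℂ) • z := by
  have hpos : 0 < star w ⬝ᵥ w := dotProduct_star_self_pos_iff.2 hw
  obtain ⟨r, hr, hry⟩ : ∃ r : ℝ, 0 < r ∧ star w ⬝ᵥ w = r := by
    rw [Complex.pos_iff] at hpos
    exact ⟨(star w ⬝ᵥ w).re, hpos.1, by apply Complex.ext <;> simp [hpos.2.symm]⟩
  obtain ⟨s, hs, hs2⟩ : ∃ s : ℝ, 0 < s ∧ s * s = r :=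
    ⟨√r, Real.sqrt_pos.2 hr, Real.mul_self_sqrt hr.le⟩
  have hs0 : (s : ℂ) ≠ 0 := by exact_mod_cast hs.ne'
  refine ⟨r, vecMulVec ((s : ℂ)⁻¹ • w) (star ((s : ℂ)⁻¹ • w)), pure_of_vec ?_, ?_⟩
  · simp only [star_smul, smul_dotProduct, dotProduct_smul, hry, ← hs2]
    simp
    field_simp
  · ext i j
    simp [vecMulVec_apply, ← hs2]
    field_simp

lemma pure_functionals {m : ℕ} (p q r : Matrix (Fin m) (Fin m) ℂ →ₗ[ℂ] ℂ)
    (hp : ∀ z, IsPureState z → (p z).im = 0)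
    (hr : ∀ z, IsPureState z → r z = p z * q z)
    {x y : Matrix (Fin m) (Fin m) ℂ} (hx : IsPureState x) (hy : IsPureState y)
    (hpx : p x = 0) (hqx : q x = 0) : p y = 0 ∨ q y = 0 := by
  by_contra hcon
  push Not at hcon
  obtain ⟨hC, hC'⟩ := hcon
  obtain ⟨v, hv, rfl⟩ := pure_vec hx
  obtain ⟨u, hu, rfl⟩ := pure_vec hy
  have hpw : ∀ w : Fin m → ℂ, (p (vecMulVec w (star w))).im = 0 ∧
      p (vecMulVec w (star w)) * q (vecMulVec w (star w)) =
        (vecMulVec w (star w)).trace * r (vecMulVec w (star w)) := by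
    intro w
    by_cases hw : w = 0
    · subst hw; simp
    obtain ⟨c, z, hz, hzw⟩ := pure_scale w hw
    rw [hzw]
    simp only [map_smul, smul_eq_mul, trace_smul, hz.2.2, hr z hz]
    refine ⟨by simp [hp z hz], by ring⟩
  let M := vecMulVec v (star u) + vecMulVec u (star v)
  have hexp : ∀ s : ℝ, vecMulVec (v + (s : ℂ) • u) (star (v + (s : ℂ) • u)) =
      vecMulVec v (star v) + (s : ℂ) • M + ((s : ℂ) ^ 2) • vecMulVec u (star u) := by
    intro s
    ext i j
    simp [M, vecMulVec_apply]
    ring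
  have key : ∀ s : ℝ, (s * p M + s ^ 2 * p (vecMulVec u (star u))) *
      (s * q M + s ^ 2 * q (vecMulVec u (star u))) =
      (1 + s * M.trace + s ^ 2) *
        (s * r M + s ^ 2 * (p (vecMulVec u (star u)) * q (vecMulVec u (star u)))) := by
    intro s
    have h := (hpw (v + (s : ℂ) • u)).2
    rw [hexp s] at h
    simp only [map_add, map_smul, smul_eq_mul, trace_add, trace_smul, hpx, hqx, hr _ hx, hr _ hy,
      hx.2.2, hy.2.2] at h
    linear_combination h
  have hBim : (p M).im = 0 := by
    have h := (hpw (v + ((1 : ℝ) : ℂ) • u)).1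
    rw [hexp 1] at h
    simp only [map_add, map_smul, smul_eq_mul, hpx, Complex.ofReal_one, one_mul, one_pow, zero_add,
      Complex.add_im, hp _ hy, add_zero] at h
    exact h
  have hCim := hp _ hy
  set C := p (vecMulVec u (star u))
  set C' := q (vecMulVec u (star u))
  set B := p M
  set B' := q M
  set E := r M
  set t := M.trace
  have k1 := key 1
  have k2 := key (-1)
  have k3 := key 2
  push_cast at k1 k2 k3
  have hE : E = 0 := by linear_combination (-1 : ℂ) * k1 + (1/3 : ℂ) * k2 + (1/6 : ℂ) * k3
  rw [hE] at k1 k2 k3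
  have h1 : B * B' = C * C' := by linear_combination (1/2 : ℂ) * k1 + (1/2 : ℂ) * k2
  have h2 : B * C' + C * B' = t * (C * C') := by linear_combination (1/2 : ℂ) * k1 - (1/2 : ℂ) * k2
  let s : ℝ := -(B.re / C.re)
  have hBre : B = (B.re : ℂ) := by apply Complex.ext <;> simp [hBim]
  have hCre : C = (C.re : ℂ) := by apply Complex.ext <;> simp [hCim]
  have hs : (s : ℂ) = -(B / C) := by
    rw [hBre, hCre]; simp [s]
  have hτ : 1 + s * t + (s : ℂ) ^ 2 = 0 := by
    rw [hs]
    have : C * C' * C * (1 + -(B / C) * t + (-(B / C)) ^ 2) = 0 := by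
      field_simp
      linear_combination (-1 : ℂ) * C * h1 - B * h2 * (-1 : ℂ)
    exact (mul_eq_zero.1 this).resolve_left (mul_ne_zero (mul_ne_zero hC hC') hC)
  have hw0 : v + (s : ℂ) • u = 0 := by
    rw [← dotProduct_self_star_eq_zero, ← trace_vecMulVec, hexp s]
    simp only [trace_add, trace_smul, hx.2.2, hy.2.2, smul_eq_mul]
    linear_combination hτ
  have hvu : v = -((s : ℂ) • u) := eq_neg_of_add_eq_zero_left hw0
  have hxy : vecMulVec v (star v) = ((s : ℂ) ^ 2) • vecMulVec u (star u) := by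
    rw [hvu]
    ext i j
    simp [vecMulVec_apply]
    ring
  have h1 := hx.2.2
  rw [hxy, trace_smul, hy.2.2, smul_eq_mul, mul_one] at h1
  rw [hxy, h1, one_smul] at hpx
  exact hC hpx

lemma pure_functionals' {m : ℕ} (p q r : Matrix (Fin m) (Fin m) ℂ →ₗ[ℂ] ℂ)
    (hp : ∀ z, IsPureState z → (p z).im = 0)
    (hr : ∀ z, IsPureState z → r z = p z * q z)
    {x y : Matrix (Fin m) (Fin m) ℂ} (hx : IsPureState x) (hy : IsPureState y) :
    p x = p y ∨ q x = q y := by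
  let tr := Matrix.traceLinearMap (Fin m) ℂ ℂ
  have htr : ∀ z : Matrix (Fin m) (Fin m) ℂ, IsPureState z → tr z = 1 := fun z hz => hz.2.2
  have := pure_functionals (p - p x • tr) (q - q x • tr)
    (r - p x • q - q x • p + (p x * q x) • tr)
    (fun z hz => by simp [htr z hz, hp z hz, hp x hx])
    (fun z hz => by
      simp only [LinearMap.add_apply, LinearMap.sub_apply, LinearMap.smul_apply, htr z hz, hr z hz,
        smul_eq_mul]
      ring) hx hy (by simp [htr x hx]) (by simp [htr x hx])
  simp only [LinearMap.sub_apply, LinearMap.smul_apply, htr y hy, smul_eq_mul, mul_one,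
    sub_eq_zero] at this
  exact this.imp Eq.symm Eq.symm

lemma herm_trace_mul_im {m : ℕ} {A B : Matrix (Fin m) (Fin m) ℂ} (hA : A.IsHermitian)
    (hB : B.IsHermitian) : ((A * B).trace).im = 0 := by
  rw [← Complex.conj_eq_iff_im]
  have := trace_conjTranspose (A * B)
  rw [conjTranspose_mul, hA.eq, hB.eq, trace_mul_comm] at this
  exact this.symm

lemma slice_adj {k : ℕ} {n : Fin k → ℕ}
    (T : Matrix (∀ i, Fin (n i)) (∀ i, Fin (n i)) ℂ →ₗ[ℂ]
      Matrix (∀ i, Fin (n i)) (∀ i, Fin (n i)) ℂ)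
    (f : (∀ i, {Q : Matrix (Fin (n i)) (Fin (n i)) ℂ // IsPureState Q}) →
      (∀ i, {Q : Matrix (Fin (n i)) (Fin (n i)) ℂ // IsPureState Q}))
    (hf : Function.Injective f)
    (hT : ∀ a, T (tensorPi fun i => (a i).1) = tensorPi fun i => (f a i).1)
    (a b : ∀ i, {Q : Matrix (Fin (n i)) (Fin (n i)) ℂ // IsPureState Q}) (i : Fin k)
    (hab : HAdj a b i) : ∃ j, HAdj (f a) (f b) j := by
  have hne : f a ≠ f b := fun h => hab.1 (congrFun (hf h) i)
  obtain ⟨j, hj⟩ := Function.ne_iff.1 hne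
  refine ⟨j, hj, fun l hl => ?_⟩
  let G := T.comp (tensorLin (fun i => (a i).1) i)
  have hG : ∀ z (hz : IsPureState z),
      G z = tensorPi fun l => (f (Function.update a i ⟨z, hz⟩) l).1 := by
    intro z hz
    rw [← hT]
    change T (tensorPi _) = _
    congr 2
    funext l
    by_cases h : l = i
    · subst h; simp
    · simp [h]
  have hGa : Function.update a i ⟨(a i).1, (a i).2⟩ = a := by simp
  have hGb : Function.update a i ⟨(b i).1, (b i).2⟩ = b := by
    funext l
    by_cases h : l = i
    · subst h; simp
    · simp [h, hab.2 l h]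
  let H1 := (f a j).1 - (f b j).1
  let H2 := (f a l).1 - (f b l).1
  have hH1 : H1.IsHermitian := (f a j).2.1.sub (f b j).2.1
  have hH2 : H2.IsHermitian := (f a l).2.1.sub (f b l).2.1
  have tr1 : ∀ (c : ∀ i, {Q : Matrix (Fin (n i)) (Fin (n i)) ℂ // IsPureState Q}) (l : Fin k),
    ((c l).1).trace = 1 := fun c l => (c l).2.2.2
  have hfin : ∀ (d : ℕ) (A B : Matrix (Fin d) (Fin d) ℂ), (A - B).IsHermitian →
      (A * (A - B)).trace = (B * (A - B)).trace → A = B := by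
    intro d A B hH h
    rw [← sub_eq_zero, ← trace_sub, ← sub_mul] at h
    have h2 : ((A - B)ᴴ * (A - B)).trace = 0 := by rw [hH.eq]; exact h
    rw [trace_conjTranspose_mul_self_eq_zero_iff] at h2
    exact sub_eq_zero.1 h2
  have := pure_functionals'
    ((tensorFun (Function.update (fun i => (1 : Matrix (Fin (n i)) (Fin (n i)) ℂ)) j H1)).comp G)
    ((tensorFun (Function.update (fun i => (1 : Matrix (Fin (n i)) (Fin (n i)) ℂ)) l H2)).comp G)
    ((tensorFun (Function.update (Function.update
      (fun i => (1 : Matrix (Fin (n i)) (Fin (n i)) ℂ)) j H1) l H2)).comp G)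
    (fun z hz => by
      rw [LinearMap.comp_apply, hG z hz, tensorFun_one _ (tr1 _)]
      exact herm_trace_mul_im (f _ j).2.1 hH1)
    (fun z hz => by
      simp only [LinearMap.comp_apply, hG z hz]
      rw [tensorFun_one _ (tr1 _), tensorFun_one _ (tr1 _), tensorFun_two _ (tr1 _) _ _ hl.symm])
    (a i).2 (b i).2
  simp only [LinearMap.comp_apply, hG _ (a i).2, hG _ (b i).2, hGa, hGb] at this
  rw [tensorFun_one _ (tr1 _), tensorFun_one _ (tr1 _), tensorFun_one _ (tr1 _),
    tensorFun_one _ (tr1 _)] at this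
  rcases this with h | h
  · exact absurd (Subtype.ext (hfin _ _ _ hH1 h)) hj
  · exact Subtype.ext (hfin _ _ _ hH2 h)


lemma pure_cast {m m' : ℕ} (h : m = m') {A : Matrix (Fin m) (Fin m) ℂ} (hA : IsPureState A) :
    IsPureState (A.submatrix (Fin.cast h.symm) (Fin.cast h.symm)) := by
  subst h
  simpa using hA

lemma pure_nontrivial {m : ℕ} (h : 2 ≤ m) :
    Nontrivial {Q : Matrix (Fin m) (Fin m) ℂ // IsPureState Q} := by
  have key : ∀ i : Fin m, IsPureState
      (vecMulVec (Pi.single i (1 : ℂ)) (star (Pi.single i (1 : ℂ)))) := by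
    intro i
    apply pure_of_vec
    simp
  refine ⟨⟨_, key ⟨0, by omega⟩⟩, ⟨_, key ⟨1, by omega⟩⟩, ?_⟩
  intro hcon
  have h1 := congrFun (congrFun (congrArg Subtype.val hcon) ⟨0, by omega⟩) ⟨0, by omega⟩
  simp [vecMulVec_apply, Pi.single_apply] at h1

/-- A left inverse on the span of the pure product states. -/
lemma exists_left_inv {k : ℕ} {n : Fin k → ℕ}
    (T : Matrix (∀ i, Fin (n i)) (∀ i, Fin (n i)) ℂ →ₗ[ℂ]
      Matrix (∀ i, Fin (n i)) (∀ i, Fin (n i)) ℂ)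
    (S : Set (Matrix (∀ i, Fin (n i)) (∀ i, Fin (n i)) ℂ)) (hS : T '' S = S) :
    ∃ T' : Matrix (∀ i, Fin (n i)) (∀ i, Fin (n i)) ℂ →ₗ[ℂ]
      Matrix (∀ i, Fin (n i)) (∀ i, Fin (n i)) ℂ, ∀ X ∈ S, T' (T X) = X := by
  let V := Submodule.span ℂ S
  have hmap : V.map T = V := by
    simp only [V, Submodule.map_span, hS]
  have hmem : ∀ x ∈ V, T x ∈ V := fun x hx => by
    rw [← hmap]; exact Submodule.mem_map_of_mem hx
  let TV : V →ₗ[ℂ] V := T.restrict hmem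
  have hsurj : Function.Surjective TV := by
    rintro ⟨y, hy⟩
    have hy' := hy
    rw [← hmap] at hy'
    obtain ⟨x, hx, rfl⟩ := hy'
    exact ⟨⟨x, hx⟩, rfl⟩
  have hinj : Function.Injective TV := LinearMap.injective_iff_surjective.2 hsurj
  have hinj2 : Function.Injective (T.comp V.subtype) := by
    intro x y hxy
    apply hinj
    exact Subtype.ext hxy
  obtain ⟨g, hg⟩ := LinearMap.exists_leftInverse_of_injective (T.comp V.subtype)
    (LinearMap.ker_eq_bot.2 hinj2)
  refine ⟨V.subtype.comp g, fun X hX => ?_⟩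
  have := LinearMap.congr_fun hg ⟨X, Submodule.subset_span hX⟩
  simp only [LinearMap.comp_apply, Submodule.subtype_apply, LinearMap.id_apply] at this
  simp [this]

lemma tensorPi_ext_pure {k : ℕ} {n : Fin k → ℕ} {M : Type*} [AddCommGroup M] [Module ℂ M]
    (F : (∀ i, Matrix (Fin (n i)) (Fin (n i)) ℂ) → M)
    (hF : ∀ A i, ∃ L : Matrix (Fin (n i)) (Fin (n i)) ℂ →ₗ[ℂ] M,
      ∀ X, F (Function.update A i X) = L X)
    (h0 : ∀ A, (∀ i, IsPureState (A i)) → F A = 0) (A) : F A = 0 := by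
  have key : ∀ s : Finset (Fin k), ∀ A : ∀ i, Matrix (Fin (n i)) (Fin (n i)) ℂ,
      (∀ i, i ∉ s → IsPureState (A i)) → F A = 0 := by
    intro s
    induction s using Finset.induction_on with
    | empty => intro A hA; exact h0 A fun i => hA i (by simp)
    | insert i s hi ih =>
      intro A hA
      obtain ⟨L, hL⟩ := hF A i
      have hL0 : L = 0 := by
        apply LinearMap.ext_on pure_span
        intro X hX
        rw [← hL]
        apply ih
        intro l hl
        by_cases hli : l = i
        · subst hli; simpa using hX
        · rw [Function.update_of_ne hli]
          exact hA l (by simp [hli, hl])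
      have := hL (A i)
      rw [Function.update_eq_self] at this
      rw [this, hL0]; rfl
  exact key Finset.univ A (by simp)

lemma forward_core {k : ℕ} {n : Fin k → ℕ} (h2 : ∀ i, 2 ≤ n i)
    (T : Matrix (∀ i, Fin (n i)) (∀ i, Fin (n i)) ℂ →ₗ[ℂ]
      Matrix (∀ i, Fin (n i)) (∀ i, Fin (n i)) ℂ)
    (hS : T '' {C | ∃ Q : ∀ i, Matrix (Fin (n i)) (Fin (n i)) ℂ,
        (∀ i, IsPureState (Q i)) ∧ C = tensorPi Q} =
      {C | ∃ Q : ∀ i, Matrix (Fin (n i)) (Fin (n i)) ℂ,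
        (∀ i, IsPureState (Q i)) ∧ C = tensorPi Q}) :
    ∃ (π : Equiv.Perm (Fin k)) (Φ : ∀ j, Matrix (Fin (n (π j))) (Fin (n (π j))) ℂ →ₗ[ℂ]
        Matrix (Fin (n j)) (Fin (n j)) ℂ),
      (∀ j A, IsPureState A → IsPureState (Φ j A)) ∧
      (∀ j B, IsPureState B → ∃ A, IsPureState A ∧ Φ j A = B) ∧
      ∀ A, T (tensorPi A) = tensorPi fun j => Φ j (A (π j)) := by
  obtain ⟨T', hT'⟩ := exists_left_inv T _ hS
  let X : Fin k → Type := fun i => {Q : Matrix (Fin (n i)) (Fin (n i)) ℂ // IsPureState Q}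
  have : ∀ i, Nontrivial (X i) := fun i => pure_nontrivial (h2 i)
  let tp : (∀ i, X i) → Matrix (∀ i, Fin (n i)) (∀ i, Fin (n i)) ℂ :=
    fun a => tensorPi fun i => (a i).1
  have tpinj : Function.Injective tp := by
    intro a b hab
    have := tensorPi_pure_inj (fun i => (a i).2) (fun i => (b i).2) hab
    funext i
    exact Subtype.ext (congrFun this i)
  have e1 : ∀ a : ∀ i, X i, ∃ b : ∀ i, X i, T (tp a) = tp b := by
    intro a
    have : T (tp a) ∈ {C | ∃ Q : ∀ i, Matrix (Fin (n i)) (Fin (n i)) ℂ,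
        (∀ i, IsPureState (Q i)) ∧ C = tensorPi Q} := by
      rw [← hS]; exact ⟨_, ⟨_, fun i => (a i).2, rfl⟩, rfl⟩
    obtain ⟨Q, hQ, h⟩ := this
    exact ⟨fun i => ⟨Q i, hQ i⟩, h⟩
  have e2 : ∀ b : ∀ i, X i, ∃ a : ∀ i, X i, T (tp a) = tp b := by
    intro b
    have : tp b ∈ T '' {C | ∃ Q : ∀ i, Matrix (Fin (n i)) (Fin (n i)) ℂ,
        (∀ i, IsPureState (Q i)) ∧ C = tensorPi Q} := by
      rw [hS]; exact ⟨_, fun i => (b i).2, rfl⟩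
    obtain ⟨_, ⟨Q, hQ, rfl⟩, h⟩ := this
    exact ⟨fun i => ⟨Q i, hQ i⟩, h⟩
  have hT2 : ∀ a : ∀ i, X i, T' (T (tp a)) = tp a := fun a => hT' _ ⟨_, fun i => (a i).2, rfl⟩
  choose f0 hf0 using e1
  choose g0 hg0 using e2
  let f : (∀ i, X i) ≃ (∀ i, X i) :=
    { toFun := f0
      invFun := g0
      left_inv := fun a => by
        apply tpinj
        rw [← hT2 (g0 (f0 a)), hg0, ← hf0, hT2]
      right_inv := fun b => by
        apply tpinj
        rw [← hf0, hg0] }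
  have hf : ∀ a, T (tp a) = tp (f a) := hf0
  have hfs : ∀ a, T' (tp a) = tp (f.symm a) := by
    intro a
    have := hf (f.symm a)
    rw [Equiv.apply_symm_apply] at this
    rw [← this, hT2]
  obtain ⟨π, hπ⟩ := hamming_main f
    (fun a b i hab => slice_adj T f f.injective hf a b i hab)
    (fun a b i hab => slice_adj T' f.symm f.symm.injective hfs a b i hab)
  have R : ∀ i, X i := fun i => Classical.arbitrary _
  let Φ : ∀ j, Matrix (Fin (n (π j))) (Fin (n (π j))) ℂ →ₗ[ℂ]
        Matrix (Fin (n j)) (Fin (n j)) ℂ := fun j =>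
    (ptr n j).comp (T.comp (tensorLin (fun i => (R i).1) (π j)))
  have hup : ∀ j (x : X (π j)), tensorLin (fun i => (R i).1) (π j) x.1 =
      tp (Function.update R (π j) x) := by
    intro j x
    show tensorPi _ = tensorPi _
    congr 1
    funext i
    by_cases hi : i = π j
    · subst hi; simp
    · simp [Function.update_of_ne hi]
  have hΦ : ∀ j (a : ∀ i, X i), Φ j (a (π j)).1 = (f a j).1 := by
    intro j a
    show ptr n j (T (tensorLin (fun i => (R i).1) (π j) (a (π j)).1)) = _
    rw [hup, hf]
    show ptr n j (tensorPi _) = _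
    rw [ptr_tensorPi _ (fun i => (f _ i).2.2.2)]
    rw [hπ j _ a (by simp)]
  refine ⟨π, Φ, ?_, ?_, ?_⟩
  · intro j A hA
    have := hΦ j (Function.update R (π j) ⟨A, hA⟩)
    rw [Function.update_self] at this
    rw [this]
    exact (f _ j).2
  · intro j B hB
    refine ⟨(f.symm (Function.update R j ⟨B, hB⟩) (π j)).1, (f.symm _ _).2, ?_⟩
    rw [hΦ, Equiv.apply_symm_apply, Function.update_self]
  · intro A
    rw [← sub_eq_zero]
    refine tensorPi_ext_pure
      (fun A => T (tensorPi A) - tensorPi fun j => Φ j (A (π j))) ?_ ?_ A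
    · intro A i
      obtain ⟨j, rfl⟩ := π.surjective i
      refine ⟨T.comp (tensorLin A (π j)) -
        (tensorLin (fun j => Φ j (A (π j))) j).comp (Φ j), fun Y => ?_⟩
      show _ = T (tensorPi _) - tensorPi _
      congr 2
      funext l
      by_cases hl : l = j
      · subst hl; simp
      · have : π l ≠ π j := fun h => hl (π.injective h)
        simp [Function.update_of_ne hl, Function.update_of_ne this]
    · intro A hA
      rw [sub_eq_zero]
      let a : ∀ i, X i := fun i => ⟨A i, hA i⟩
      have h1 := hf a
      have h3 : (fun j => Φ j (A (π j))) = fun j => (f a j).1 := by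
        funext j
        exact hΦ j a
      rw [h3]
      exact h1

/-- The complex-linear extension of a real-linear map on Hermitian matrices. -/
noncomputable def cplx {I : Type} [Fintype I] [DecidableEq I]
    (Ψ : selfAdjoint (Matrix I I ℂ) →ₗ[ℝ] selfAdjoint (Matrix I I ℂ)) :
    Matrix I I ℂ →ₗ[ℂ] Matrix I I ℂ where
  toFun X := (Ψ (realPart X) : Matrix I I ℂ) + Complex.I • (Ψ (imaginaryPart X) : Matrix I I ℂ)
  map_add' X Y := by
    simp only [map_add, AddSubgroup.coe_add, smul_add]
    abel
  map_smul' c X := by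
    simp only [realPart_smul, imaginaryPart_smul, map_add, map_sub, map_smul, RingHom.id_apply,
      AddSubgroup.coe_add, AddSubgroup.coe_sub, selfAdjoint.val_smul]
    ext x y
    simp only [Matrix.add_apply, Matrix.sub_apply, Matrix.smul_apply, smul_eq_mul,
      Complex.real_smul]
    conv_rhs => rw [← Complex.re_add_im c]
    linear_combination (- (c.im : ℂ) * ((Ψ (imaginaryPart X) : Matrix I I ℂ) x y)) * Complex.I_mul_I

lemma cplx_coe {I : Type} [Fintype I] [DecidableEq I]
    (Ψ : selfAdjoint (Matrix I I ℂ) →ₗ[ℝ] selfAdjoint (Matrix I I ℂ))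
    (X : selfAdjoint (Matrix I I ℂ)) : cplx Ψ X = Ψ X := by
  simp [cplx]

lemma pure_conj {m : ℕ} {U A : Matrix (Fin m) (Fin m) ℂ} (hU : U ∈ Matrix.unitaryGroup (Fin m) ℂ)
    (hA : IsPureState A) : IsPureState (U * A * Uᴴ) := by
  obtain ⟨v, hv, rfl⟩ := pure_vec hA
  have hU1 : Uᴴ * U = 1 := Matrix.mem_unitaryGroup_iff'.1 hU
  have : U * vecMulVec v (star v) * Uᴴ = vecMulVec (U *ᵥ v) (star (U *ᵥ v)) := by
    rw [mul_vecMulVec, vecMulVec_mul, star_mulVec]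
  rw [this]
  apply pure_of_vec
  rw [star_mulVec, ← dotProduct_mulVec, mulVec_mulVec, hU1, one_mulVec, hv]

lemma pure_transpose {m : ℕ} {A : Matrix (Fin m) (Fin m) ℂ}
    (hA : IsPureState A) : IsPureState Aᵀ := by
  obtain ⟨v, hv, rfl⟩ := pure_vec hA
  have := pure_of_vec (v := star v) (by rw [star_star, dotProduct_comm]; exact hv)
  rw [star_star] at this
  rwa [transpose_vecMulVec]

lemma form_pure {m : ℕ} (ψ : Matrix (Fin m) (Fin m) ℂ → Matrix (Fin m) (Fin m) ℂ)
    (h : ∃ U ∈ Matrix.unitaryGroup (Fin m) ℂ,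
      (∀ X, ψ X = U * X * Uᴴ) ∨ (∀ X, ψ X = U * Xᵀ * Uᴴ)) :
    (∀ A, IsPureState A → IsPureState (ψ A)) ∧
    (∀ B, IsPureState B → ∃ A, IsPureState A ∧ ψ A = B) := by
  obtain ⟨U, hU, h⟩ := h
  have hU1 : U * Uᴴ = 1 := Matrix.mem_unitaryGroup_iff.1 hU
  have hU' : Uᴴ ∈ Matrix.unitaryGroup (Fin m) ℂ := Unitary.star_mem hU
  have hB : ∀ B, U * (Uᴴ * B * Uᴴᴴ) * Uᴴ = B := by
    intro B
    rw [conjTranspose_conjTranspose]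
    calc U * (Uᴴ * B * U) * Uᴴ = (U * Uᴴ) * B * (U * Uᴴ) := by simp only [mul_assoc]
      _ = B := by rw [hU1, one_mul, mul_one]
  rcases h with h | h
  · refine ⟨fun A hA => by rw [h]; exact pure_conj hU hA, fun B hBp =>
      ⟨_, pure_conj hU' hBp, by rw [h, hB]⟩⟩
  · refine ⟨fun A hA => by rw [h]; exact pure_conj hU (pure_transpose hA), fun B hBp =>
      ⟨_, pure_transpose (pure_conj hU' hBp), by rw [h, transpose_transpose, hB]⟩⟩

/-- Theorem 3.1 (multipartite case): for `k > 1` and `n₁ ≥ ⋯ ≥ n_k ≥ 2`, an `ℝ`-linear map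
`Ψ` on `H_N ≡ ⊗_{i=1}^k H_{n_i}` satisfies `Ψ(⊗ P_{n_i}) = ⊗ P_{n_i}` if and only if there
are a permutation `π` of `{1,…,k}` with `n_{π(i)} = n_i` and maps `ψ_i`, each of the form
`X ↦ U_i X U_i*` or `X ↦ U_i Xᵀ U_i*` for a unitary `U_i`, such that
`Ψ(⊗ A_i) = ⊗ ψ_i(A_{π(i)})` for all Hermitian `A_i`. -/
theorem multipartite_pure_tensor_preserver_form (k : ℕ) (hk : 1 < k) (n : Fin k → ℕ)
    (hmono : ∀ i j : Fin k, i ≤ j → n j ≤ n i) (h2 : ∀ i, 2 ≤ n i)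
    (Ψ : selfAdjoint (Matrix (∀ i, Fin (n i)) (∀ i, Fin (n i)) ℂ) →ₗ[ℝ]
          selfAdjoint (Matrix (∀ i, Fin (n i)) (∀ i, Fin (n i)) ℂ)) :
    Ψ '' PureTensor n = PureTensor n ↔
      ∃ (π : Equiv.Perm (Fin k)) (hπ : ∀ i, n (π i) = n i)
        (ψ : ∀ i, Matrix (Fin (n i)) (Fin (n i)) ℂ → Matrix (Fin (n i)) (Fin (n i)) ℂ),
        (∀ i, ∃ U : Matrix (Fin (n i)) (Fin (n i)) ℂ,
          U ∈ Matrix.unitaryGroup (Fin (n i)) ℂ ∧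
            ((∀ X, ψ i X = U * X * Uᴴ) ∨ (∀ X, ψ i X = U * Xᵀ * Uᴴ))) ∧
        ∀ A : ∀ i, Herm (n i),
          (Ψ (tensorSA A) : Matrix (∀ i, Fin (n i)) (∀ i, Fin (n i)) ℂ) =
            tensorPi fun i =>
              ψ i (((A (π i) : Matrix (Fin (n (π i))) (Fin (n (π i))) ℂ)).submatrix
                (Fin.cast (hπ i).symm) (Fin.cast (hπ i).symm)) := by
  constructor
  · intro h
    obtain ⟨π, Φ, hP, hS, hT⟩ := forward_core h2 (cplx Ψ) (by
      ext C
      constructor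
      · rintro ⟨_, ⟨Q, hQ, rfl⟩, rfl⟩
        let C0 := tensorSA (fun i => (⟨Q i, (hQ i).1⟩ : Herm (n i)))
        have h1 : Ψ C0 ∈ PureTensor n := by
          rw [← h]; exact ⟨C0, ⟨Q, hQ, rfl⟩, rfl⟩
        obtain ⟨Q', hQ', h3⟩ := h1
        refine ⟨Q', hQ', ?_⟩
        rw [← h3, ← cplx_coe]
        rfl
      · rintro ⟨Q, hQ, rfl⟩
        let C0 := tensorSA (fun i => (⟨Q i, (hQ i).1⟩ : Herm (n i)))
        have h1 : C0 ∈ Ψ '' PureTensor n := by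
          rw [h]; exact ⟨Q, hQ, rfl⟩
        obtain ⟨C1, ⟨Q', hQ', h3⟩, h4⟩ := h1
        refine ⟨C1, ⟨Q', hQ', h3⟩, ?_⟩
        rw [cplx_coe, h4]
        rfl)
    have hle : ∀ j ∈ Finset.univ, n j ≤ n (π j) := fun j _ => pres_dim (Φ j) (hP j) (hS j)
    have heq := (Finset.sum_eq_sum_iff_of_le hle).1 (Equiv.sum_comp π n).symm
    have hπ : ∀ i, n (π i) = n i := fun i => (heq i (Finset.mem_univ i)).symm
    refine ⟨π, hπ, fun i X => Φ i (X.submatrix (Fin.cast (hπ i)) (Fin.cast (hπ i))), ?_, ?_⟩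
    · intro i
      let e := Matrix.reindexLinearEquiv ℂ ℂ (finCongr (hπ i).symm) (finCongr (hπ i).symm)
      obtain ⟨U, hU, hform⟩ := wigner_form ((Φ i).comp e.toLinearMap)
        (fun A hA => hP i _ (pure_cast (hπ i).symm hA))
        (fun B hB => by
          obtain ⟨A, hA, hAB⟩ := hS i B hB
          refine ⟨_, pure_cast (hπ i) hA, ?_⟩
          rw [← hAB]
          rfl)
      exact ⟨U, hU, hform⟩
    · intro A
      rw [← cplx_coe]
      exact hT _
  · rintro ⟨π, hπ, ψ, hψ, hΨ⟩
    have hp := fun i => form_pure (ψ i) (hψ i)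
    ext C
    constructor
    · rintro ⟨C, ⟨Q, hQ, hC⟩, rfl⟩
      have hC' : C = tensorSA (fun i => (⟨Q i, (hQ i).1⟩ : Herm (n i))) := Subtype.ext hC
      rw [hC']
      exact ⟨_, fun i => (hp i).1 _ (pure_cast (hπ i) (hQ (π i))), hΨ _⟩
    · rintro ⟨Q, hQ, hC⟩
      choose B hB hBQ using fun i => (hp i).2 (Q i) (hQ i)
      have key : ∀ l, ∃ A : Matrix (Fin (n l)) (Fin (n l)) ℂ, IsPureState A ∧
          ∀ i (hi : π i = l), A.submatrix (Fin.cast (by rw [← hi, hπ i]))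
            (Fin.cast (by rw [← hi, hπ i])) = B i := by
        intro l
        obtain ⟨i, rfl⟩ := π.surjective l
        refine ⟨_, pure_cast (hπ i).symm (hB i), ?_⟩
        intro i' hi'
        obtain rfl := π.injective hi'
        rfl
      choose A hA hAB using key
      refine ⟨tensorSA (fun i => (⟨A i, (hA i).1⟩ : Herm (n i))), ⟨A, hA, rfl⟩, ?_⟩
      apply Subtype.ext
      rw [hΨ, hC]
      congr 1
      funext i
      rw [← hBQ i]
      congr 1
      exact hAB (π i) i rfl
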